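/- arXiv:0801.0687 — 2 statements merged into one kernel-verified Lean document; each statement's English description precedes it below -/
import Mathlib

section
/- For every x = (x_1, …, x_s) ∈ 𝒫_s(r), one has ∑_{n=1}^s x_n² ≤ 2s·(r/2)^{2/s}. -/
open Real

/-- For an integer `s ≥ 2` and a real number `r ≥ 0`, membership in the set
`𝒫_s(r) ⊂ ℝ^s` of tuples `x = (x_1, …, x_s)` with `x_1 ≤ x_2 ≤ … ≤ x_s`,
`∑_{n=1}^s x_n = 0`, and `|∏_{n=1}^s (z − x_n)| ≤ r` for all `z ∈ [x_1, x_s]`. -/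
def memP (s : ℕ) (hs : 2 ≤ s) (r : ℝ) (x : Fin s → ℝ) : Prop :=
  Monotone x ∧ (∑ n, x n = 0) ∧
    ∀ z ∈ Set.Icc (x ⟨0, by omega⟩) (x ⟨s - 1, by omega⟩),
      |∏ n, (z - x n)| ≤ r

open Polynomial in
/-- A monic real-rooted polynomial of degree `card ι` which is bounded by `2 ^ (1 - card ι)` on an
interval forces that interval to have length at most `2`. -/
theorem length_le_two_of_abs_prod_le {ι : Type*} [Fintype ι] [Nonempty ι] {x : ι → ℝ} {a b : ℝ}
    (h : ∀ z ∈ Set.Icc a b, |∏ i, (z - x i)| ≤ ((2 : ℝ) ^ (Fintype.card ι - 1))⁻¹) :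
    b - a ≤ 2 := by
  set n := Fintype.card ι with hn
  by_contra! hab
  set Q : ℝ[X] := C (2 ^ (n - 1)) * ∏ i, (C ((b - a) / 2) * X + C ((a + b) / 2 - x i)) with hQ
  have hdeg : ∀ i ∈ Finset.univ,
      (C ((b - a) / 2) * X + C ((a + b) / 2 - x i)).natDegree ≤ 1 :=
    fun i _ ↦ natDegree_linear_le
  have hcoeff : Q.coeff n = 2 ^ (n - 1) * ((b - a) / 2) ^ n := by
    have := coeff_prod_of_natDegree_le Finset.univ _ 1 hdeg
    rw [mul_one, Finset.card_univ, ← hn] at this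
    rw [hQ, coeff_C_mul, this]
    simp [coeff_C, hn, div_pow]
  have hQdeg : Q.degree ≤ n := by
    refine degree_le_of_natDegree_le ((natDegree_C_mul_le _ _).trans ?_)
    refine (natDegree_prod_le _ _).trans ((Finset.sum_le_sum hdeg).trans ?_)
    simp [hn]
  have hle := Chebyshev.coeff_le_of_forall_abs_le_one hQdeg fun z hz ↦ by
    have := h ((b - a) / 2 * z + (a + b) / 2) ⟨by nlinarith [hz.1], by nlinarith [hz.2]⟩
    rw [← one_div, le_div_iff₀ (by positivity)] at this
    simp only [hQ, eval_mul, eval_C, eval_prod, eval_add, eval_X, abs_mul, abs_pow, abs_two]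
    rw [mul_comm]
    simpa only [add_sub_assoc] using this
  have hlt : 1 < ((b - a) / 2) ^ n := one_lt_pow₀ (by linarith) Fintype.card_ne_zero
  rw [hcoeff] at hle
  have : (0 : ℝ) < 2 ^ (n - 1) := by positivity
  nlinarith

open Polynomial in
/-- A polynomial with simple real roots separated by points where it takes the value `±R` is the
only monic polynomial of its degree that is bounded by `R` at these points. -/
theorem eq_prod_X_sub_C_of_interlacing {n : ℕ} {x : Fin n → ℝ} {t : Fin (n + 1) → ℝ} {R : ℝ}
    (hlt : ∀ i : Fin n, t i.castSucc < x i) (hgt : ∀ i : Fin n, x i < t i.succ)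
    (hR : ∀ k, |∏ i, (t k - x i)| = R) {T : ℝ[X]} (hdeg : T.degree ≤ n) (hmonic : T.coeff n = 1)
    (hT : ∀ k, |T.eval (t k)| ≤ R) : T = ∏ i, (X - C (x i)) := by
  have hmono : StrictMono t := Fin.strictMono_iff_lt_succ.2 fun i ↦ (hlt i).trans (hgt i)
  have hpdeg : (∏ i, (X - C (x i))).degree = (n : WithBot ℕ) := by
    simp [degree_prod]
  have hpcoeff : (∏ i, (X - C (x i))).coeff n = 1 := by
    have := (monic_prod_X_sub_C x Finset.univ).coeff_natDegree
    rwa [natDegree_eq_of_degree_eq_some hpdeg] at this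
  have hcard : (Finset.univ : Finset (Fin (n + 1))).card = n + 1 := by simp
  have hlagrange {P : ℝ[X]} (hP : P.degree ≤ n) :
      P.coeff n = ∑ k, P.eval (t k) / ∏ j ∈ Finset.univ.erase k, (t k - t j) := by
    have := Lagrange.coeff_eq_sum (s := Finset.univ) (v := t) hmono.injective.injOn (P := P)
      (by rw [hcard]; exact hP.trans_lt (by exact_mod_cast n.lt_succ_self))
    rwa [hcard] at this
  have hpos (k : Fin (n + 1)) :
      0 < (∏ i, (t k - x i)) * ∏ j ∈ Finset.univ.erase k, (t k - t j) := by
    have : ∏ j ∈ Finset.univ.erase k, (t k - t j) = ∏ i, (t k - t (k.succAbove i)) := by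
      rw [← Finset.prod_image (f := fun j ↦ t k - t j) (g := k.succAbove)
        (k.succAbove_right_injective.injOn)]
      congr 1
      ext j
      simp
    rw [this, ← Finset.prod_mul_distrib]
    refine Finset.prod_pos fun i _ ↦ ?_
    rcases lt_or_ge i.castSucc k with hik | hik
    · rw [Fin.succAbove_of_castSucc_lt _ _ hik]
      have h1 : t i.succ ≤ t k := hmono.monotone (Fin.castSucc_lt_iff_succ_le.1 hik)
      exact mul_pos (by linarith [hgt i]) (by linarith [hmono hik])
    · rw [Fin.succAbove_of_le_castSucc _ _ hik]
      have h1 : t k ≤ t i.castSucc := hmono.monotone hik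
      exact mul_pos_of_neg_of_neg (by linarith [hlt i]) (by linarith [hlt i, hgt i])
  have hterm (k : Fin (n + 1)) :
      T.eval (t k) / ∏ j ∈ Finset.univ.erase k, (t k - t j) ≤
        (∏ i, (X - C (x i))).eval (t k) / ∏ j ∈ Finset.univ.erase k, (t k - t j) := by
    have hk := hpos k
    have hRk := hR k
    have hTk := abs_le.1 (hT k)
    simp only [eval_prod, eval_sub, eval_X, eval_C]
    rcases pos_and_pos_or_neg_and_neg_of_mul_pos hk with ⟨h1, h2⟩ | ⟨h1, h2⟩
    · rw [abs_of_pos h1] at hRk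
      exact div_le_div_of_nonneg_right (by linarith) h2.le
    · rw [abs_of_neg h1] at hRk
      exact div_le_div_of_nonpos_of_le h2.le (by linarith)
  have hsum := (hlagrange hdeg).symm.trans (hmonic.trans (hpcoeff.symm.trans (hlagrange hpdeg.le)))
  have heq := (Finset.sum_eq_sum_iff_of_le fun k _ ↦ hterm k).1 hsum
  have hlt' : (n : WithBot ℕ) < (Finset.univ : Finset (Fin (n + 1))).card := by
    rw [hcard]; exact_mod_cast n.lt_succ_self
  refine eq_of_degrees_lt_of_eval_index_eq Finset.univ hmono.injective.injOn
    (hdeg.trans_lt hlt') (hpdeg.le.trans_lt hlt') fun k hk ↦ ?_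
  exact (div_left_inj' (right_ne_zero_of_mul (hpos k).ne')).1 (heq k hk)

theorem sum_cos_sq_chebyshev_roots {n : ℕ} (hn : 2 ≤ n) :
    ∑ k ∈ Finset.range n, cos ((2 * k + 1) * π / (2 * n)) ^ 2 = n / 2 := by
  have hn0 : (n : ℝ) ≠ 0 := by positivity
  have hsin : 0 < sin (π / n) := by
    refine sin_pos_of_pos_of_lt_pi (by positivity) (div_lt_self pi_pos ?_)
    exact_mod_cast hn
  have htel : ∑ k ∈ Finset.range n, 2 * sin (π / n) * cos ((2 * k + 1) * π / n) = 0 := by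
    have (k : ℕ) : 2 * sin (π / n) * cos ((2 * k + 1) * π / n) =
        sin (2 * ((k + 1 : ℕ) : ℝ) * π / n) - sin (2 * (k : ℝ) * π / n) := by
      rw [sin_sub_sin]
      push_cast
      congr 2 <;> [congr 1; skip] <;> field
    simp_rw [this]
    rw [Finset.sum_range_sub (fun k : ℕ ↦ sin (2 * (k : ℝ) * π / n))]
    have : 2 * (n : ℝ) * π / n = 2 * π := by field
    simp [this]
  rw [← Finset.mul_sum] at htel
  have hcos := (mul_eq_zero.1 htel).resolve_left (by positivity)
  have (k : ℕ) : cos ((2 * k + 1) * π / (2 * n)) ^ 2 = 1 / 2 + cos ((2 * k + 1) * π / n) / 2 := by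
    rw [cos_sq]
    congr 3
    field
  simp_rw [this]
  rw [Finset.sum_add_distrib, ← Finset.sum_div _ (fun k : ℕ ↦ cos ((2 * k + 1) * π / n)), hcos]
  simp
  ring

/-- A centred tuple of reals whose monic polynomial is bounded by `R` between any two roots. -/
def IsCentredBounded {ι : Type*} [Fintype ι] (R : ℝ) (x : ι → ℝ) : Prop :=
  ∑ i, x i = 0 ∧ ∀ i j, ∀ z ∈ Set.Icc (x i) (x j), |∏ n, (z - x n)| ≤ R

theorem isCentredBounded_iff_segment {ι : Type*} [Fintype ι] {R : ℝ} {x : ι → ℝ} :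
    IsCentredBounded R x ↔ ∑ i, x i = 0 ∧
      ∀ i j, ∀ t ∈ Set.Icc (0 : ℝ) 1, |∏ n, (x i + t * (x j - x i) - x n)| ≤ R := by
  refine and_congr_right fun _ ↦ ⟨fun h i j t ht ↦ ?_, fun h i j z hz ↦ ?_⟩
  · rcases le_total (x i) (x j) with hij | hij
    · exact h i j _ ⟨by nlinarith [ht.1], by nlinarith [ht.2]⟩
    · exact h j i _ ⟨by nlinarith [ht.2], by nlinarith [ht.1]⟩
  · rw [← segment_eq_Icc (hz.1.trans hz.2), segment_eq_image'] at hz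
    obtain ⟨t, ht, rfl⟩ := hz
    exact h i j t ht

theorem isClosed_setOf_isCentredBounded {ι : Type*} [Fintype ι] (R : ℝ) :
    IsClosed {x : ι → ℝ | IsCentredBounded R x} := by
  simp only [isCentredBounded_iff_segment, Set.ofPred_and, Set.ofPred_forall]
  refine (isClosed_eq (by fun_prop) continuous_const).inter ?_
  refine isClosed_iInter fun i ↦ isClosed_iInter fun j ↦ isClosed_iInter fun t ↦
    isClosed_iInter fun _ ↦ isClosed_le (by fun_prop) continuous_const

theorem isCompact_setOf_isCentredBounded {ι : Type*} [Fintype ι] [Nonempty ι] :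
    IsCompact {x : ι → ℝ | IsCentredBounded ((2 : ℝ) ^ (Fintype.card ι - 1))⁻¹ x} := by
  refine (isCompact_Icc (a := fun _ : ι ↦ (-2 : ℝ)) (b := fun _ ↦ 2)).of_isClosed_subset
    (isClosed_setOf_isCentredBounded _) fun x hx ↦ ?_
  have hlen (i j : ι) : x j - x i ≤ 2 := length_le_two_of_abs_prod_le (hx.2 i j)
  have hcard : (0 : ℝ) < Fintype.card ι := by exact_mod_cast Fintype.card_pos
  refine ⟨fun i ↦ ?_, fun i ↦ ?_⟩
  · have := Finset.sum_le_sum fun j (_ : j ∈ Finset.univ) ↦ hlen i j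
    simp only [Finset.sum_sub_distrib, hx.1, Finset.sum_const, Finset.card_univ,
      nsmul_eq_mul] at this
    change -2 ≤ x i
    nlinarith
  · have := Finset.sum_le_sum fun j (_ : j ∈ Finset.univ) ↦ hlen j i
    simp only [Finset.sum_sub_distrib, hx.1, Finset.sum_const, Finset.card_univ,
      nsmul_eq_mul] at this
    change x i ≤ 2
    nlinarith

theorem IsCentredBounded.comp_perm {ι : Type*} [Fintype ι] {R : ℝ} {x : ι → ℝ}
    (hx : IsCentredBounded R x) (σ : Equiv.Perm ι) : IsCentredBounded R (x ∘ σ) := by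
  refine ⟨(Equiv.sum_comp σ x).trans hx.1, fun i j z hz ↦ ?_⟩
  simpa only [Function.comp_apply, Equiv.prod_comp σ (fun n ↦ z - x n)] using hx.2 _ _ z hz

/-- If the polynomial stays strictly below the bound between two roots, these roots can be pushed
apart, which increases the sum of squares. -/
theorem IsCentredBounded.exists_sum_sq_lt {ι : Type*} [Fintype ι] {R : ℝ}
    {x : ι → ℝ} (hx : IsCentredBounded R x) {k l : ι} (hkl : k ≠ l) (hle : x k ≤ x l)
    (hlt : ∀ z ∈ Set.Icc (x k) (x l), |∏ n, (z - x n)| < R) :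
    ∃ y : ι → ℝ, IsCentredBounded R y ∧ ∑ n, x n ^ 2 < ∑ n, y n ^ 2 := by
  classical
  set s : Finset ι := (Finset.univ.erase k).erase l with hs
  have hlmem : l ∈ Finset.univ.erase k := by simp [hkl.symm]
  have hprod (f : ι → ℝ) : ∏ n, f n = f k * (f l * ∏ n ∈ s, f n) := by
    rw [Finset.mul_prod_erase _ _ hlmem, Finset.mul_prod_erase _ _ (Finset.mem_univ k)]
  have hsum (f : ι → ℝ) : ∑ n, f n = f k + (f l + ∑ n ∈ s, f n) := by
    rw [Finset.add_sum_erase _ _ hlmem, Finset.add_sum_erase _ _ (Finset.mem_univ k)]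
  have hsmall : ∀ᶠ δ : ℝ in nhds 0, ∀ t ∈ Set.Icc (0 : ℝ) 1,
      |(t * (x l - x k + 2 * δ)) * ((x k - δ + t * (x l - x k + 2 * δ) - (x l + δ)) *
        ∏ n ∈ s, (x k - δ + t * (x l - x k + 2 * δ) - x n))| < R := by
    refine isCompact_Icc.eventually_forall_of_forall_eventually fun t ht ↦ ?_
    refine ContinuousAt.eventually_lt (by fun_prop) continuousAt_const ?_
    have := hlt (x k + t * (x l - x k)) ⟨by nlinarith [ht.1], by nlinarith [ht.2]⟩
    rw [hprod] at this
    simpa using this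
  obtain ⟨δ, hδ, hδpos⟩ := ((hsmall.filter_mono nhdsWithin_le_nhds).and
    (self_mem_nhdsWithin : Set.Ioi (0 : ℝ) ∈ nhdsWithin 0 (Set.Ioi 0))).exists
  set y : ι → ℝ := Function.update (Function.update x k (x k - δ)) l (x l + δ) with hy
  have hyk : y k = x k - δ := by simp [hy, hkl]
  have hyl : y l = x l + δ := by simp [hy]
  have hyn {n : ι} (hnk : n ≠ k) (hnl : n ≠ l) : y n = x n := by simp [hy, hnk, hnl]
  have hys {n : ι} (hn : n ∈ s) : y n = x n := by
    simp only [hs, Finset.mem_erase] at hn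
    exact hyn hn.2.1 hn.1
  have hprody (z : ℝ) : ∏ n, (z - y n) =
      (z - (x k - δ)) * ((z - (x l + δ)) * ∏ n ∈ s, (z - x n)) := by
    rw [hprod, hyk, hyl, Finset.prod_congr rfl fun n hn ↦ by rw [hys hn]]
  have hcompare {z : ℝ} (hz : z < x k - δ ∨ x l + δ < z) :
      |∏ n, (z - y n)| ≤ |∏ n, (z - x n)| := by
    rw [hprody, hprod]
    simp only [← mul_assoc]
    rw [abs_mul, abs_mul (_ * _)]
    refine mul_le_mul_of_nonneg_right ?_ (abs_nonneg _)
    rw [abs_of_pos, abs_of_pos]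
    · nlinarith
    · rcases hz with hz | hz
      · exact mul_pos_of_neg_of_neg (by linarith) (by linarith)
      · exact mul_pos (by linarith) (by linarith)
    · rcases hz with hz | hz
      · exact mul_pos_of_neg_of_neg (by linarith) (by linarith)
      · exact mul_pos (by linarith) (by linarith)
  refine ⟨y, ⟨?_, fun i j z hz ↦ ?_⟩, ?_⟩
  · rw [hsum, hyk, hyl, Finset.sum_congr rfl fun n hn ↦ hys hn]
    have := hx.1
    rw [hsum] at this
    linarith
  · rcases lt_or_ge z (x k - δ) with hzk | hzk
    · refine (hcompare (.inl hzk)).trans (hx.2 i k z ⟨?_, by linarith⟩)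
      have hik : i ≠ k := by rintro rfl; linarith [hz.1]
      have hil : i ≠ l := by rintro rfl; linarith [hz.1]
      exact hyn hik hil ▸ hz.1
    rcases lt_or_ge (x l + δ) z with hzl | hzl
    · refine (hcompare (.inr hzl)).trans (hx.2 l j z ⟨by linarith, ?_⟩)
      have hjk : j ≠ k := by rintro rfl; linarith [hz.2]
      have hjl : j ≠ l := by rintro rfl; linarith [hz.2]
      exact hyn hjk hjl ▸ hz.2
    have hw : 0 < x l - x k + 2 * δ := by linarith
    have := hδ ((z - (x k - δ)) / (x l - x k + 2 * δ))
      ⟨div_nonneg (by linarith) hw.le, (div_le_one hw).2 (by linarith)⟩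
    rw [div_mul_cancel₀ _ hw.ne', add_sub_cancel] at this
    rw [hprody]
    exact this.le
  · rw [hsum, hsum (fun n ↦ y n ^ 2), hyk, hyl,
      Finset.sum_congr rfl fun n hn ↦ by rw [← hys hn]]
    nlinarith

/-- If the polynomial attains its bound between any two consecutive roots, there are points
separating the roots at which it attains the bound, contained in an interval of length `2`. -/
theorem IsCentredBounded.exists_interlacing {m : ℕ} {x : Fin (m + 1) → ℝ} (hmono : Monotone x)
    (hx : IsCentredBounded ((2 : ℝ) ^ m)⁻¹ x)
    (hattain : ∀ k : Fin m, ∃ z ∈ Set.Icc (x k.castSucc) (x k.succ),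
      ((2 : ℝ) ^ m)⁻¹ ≤ |∏ n, (z - x n)|) :
    ∃ (c : ℝ) (t : Fin (m + 2) → ℝ), (∀ i, t i.castSucc < x i) ∧ (∀ i, x i < t i.succ) ∧
      (∀ k, |∏ n, (t k - x n)| = ((2 : ℝ) ^ m)⁻¹) ∧ ∀ k, |t k - c| ≤ 1 := by
  set R : ℝ := ((2 : ℝ) ^ m)⁻¹ with hR
  have hRpos : 0 < R := by positivity
  have hR1 : R ≤ 1 := inv_le_one_of_one_le₀ (one_le_pow₀ one_le_two)
  have hzero (i) : ∏ n, (x i - x n) = 0 := Finset.prod_eq_zero (Finset.mem_univ i) (sub_self _)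
  have hne {z : ℝ} (hz : |∏ n, (z - x n)| = R) (i) : x i ≠ z := by
    rintro rfl
    rw [hzero, abs_zero] at hz
    exact hRpos.ne hz
  have hcont : Continuous fun z ↦ |∏ n, (z - x n)| := by fun_prop
  obtain ⟨a, ha, haR⟩ : ∃ a ≤ x 0, |∏ n, (a - x n)| = R := by
    have hge : R ≤ |∏ n, (x 0 - 1 - x n)| := by
      rw [Finset.abs_prod]
      refine hR1.trans
        (Finset.prod_const_one (s := (Finset.univ : Finset (Fin (m + 1)))).ge.trans ?_)
      refine Finset.prod_le_prod (fun _ _ ↦ zero_le_one) fun n _ ↦ ?_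
      rw [abs_of_neg] <;> linarith [hmono (Fin.zero_le n)]
    obtain ⟨a, ha, haR⟩ := intermediate_value_Icc' (show x 0 - 1 ≤ x 0 by linarith)
      hcont.continuousOn ⟨by simp only [hzero, abs_zero, hRpos.le], hge⟩
    exact ⟨a, ha.2, haR⟩
  obtain ⟨b, hb, hbR⟩ : ∃ b ≥ x (Fin.last m), |∏ n, (b - x n)| = R := by
    have hge : R ≤ |∏ n, (x (Fin.last m) + 1 - x n)| := by
      rw [Finset.abs_prod]
      refine hR1.trans
        (Finset.prod_const_one (s := (Finset.univ : Finset (Fin (m + 1)))).ge.trans ?_)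
      refine Finset.prod_le_prod (fun _ _ ↦ zero_le_one) fun n _ ↦ ?_
      rw [abs_of_pos] <;> linarith [hmono (Fin.le_last n)]
    obtain ⟨b, hb, hbR⟩ := intermediate_value_Icc
      (show x (Fin.last m) ≤ x (Fin.last m) + 1 by linarith)
      hcont.continuousOn ⟨by simp only [hzero, abs_zero, hRpos.le], hge⟩
    exact ⟨b, hb.1, hbR⟩
  have hab : b - a ≤ 2 := by
    refine length_le_two_of_abs_prod_le (x := x) fun z hz ↦ ?_
    rw [Fintype.card_fin, Nat.add_sub_cancel, ← hR]
    rcases lt_or_ge z (x 0) with hz0 | hz0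
    · rw [← haR, Finset.abs_prod, Finset.abs_prod]
      refine Finset.prod_le_prod (fun _ _ ↦ abs_nonneg _) fun n _ ↦ ?_
      have := hmono (Fin.zero_le n)
      rw [abs_of_nonpos, abs_of_nonpos] <;> linarith [hz.1]
    rcases lt_or_ge (x (Fin.last m)) z with hz1 | hz1
    · rw [← hbR, Finset.abs_prod, Finset.abs_prod]
      refine Finset.prod_le_prod (fun _ _ ↦ abs_nonneg _) fun n _ ↦ ?_
      have := hmono (Fin.le_last n)
      rw [abs_of_nonneg, abs_of_nonneg] <;> linarith [hz.2]
    · exact hx.2 _ _ z ⟨hz0, hz1⟩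
  have hex (k : Fin (m + 2)) : ∃ z, |∏ n, (z - x n)| = R ∧ (∀ i, i.castSucc < k → x i < z) ∧
      (∀ i, k ≤ i.castSucc → z < x i) ∧ z ∈ Set.Icc a b := by
    have h0b : x 0 ≤ b := (hmono (Fin.zero_le _)).trans hb
    induction k using Fin.cases with
    | zero =>
      exact ⟨a, haR, fun i hi ↦ absurd hi (Fin.not_lt_zero _),
        fun i _ ↦ ((ha.trans (hmono (Fin.zero_le i))).lt_of_ne' (hne haR i)),
        le_rfl, ha.trans h0b⟩
    | succ k =>
      induction k using Fin.lastCases with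
      | last =>
        exact ⟨b, hbR, fun i _ ↦ ((hmono (Fin.le_last i)).trans hb).lt_of_ne (hne hbR i),
          fun i hi ↦ absurd hi (not_le.2 (Fin.castSucc_lt_last i)), ha.trans h0b, le_rfl⟩
      | cast k =>
        obtain ⟨z, hz, hzR⟩ := hattain k
        replace hzR := (hx.2 _ _ z hz).antisymm hzR
        refine ⟨z, hzR, fun i hi ↦ ?_, fun i hi ↦ ?_, ?_, ?_⟩
        · refine ((hmono ?_).trans hz.1).lt_of_ne (hne hzR i)
          simp only [Fin.lt_def, Fin.le_def, Fin.val_castSucc, Fin.val_succ] at hi ⊢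
          omega
        · refine (hz.2.trans (hmono ?_)).lt_of_ne' (hne hzR i)
          simpa only [Fin.le_def, Fin.val_castSucc, Fin.val_succ] using hi
        · exact ha.trans ((hmono (Fin.zero_le _)).trans hz.1)
        · exact hz.2.trans ((hmono (Fin.le_last _)).trans hb)
  choose t ht hxt htx htab using hex
  refine ⟨(a + b) / 2, t, fun i ↦ htx _ i le_rfl, fun i ↦ hxt _ i i.castSucc_lt_succ, ht,
    fun k ↦ abs_le.2 ⟨?_, ?_⟩⟩ <;> linarith [(htab k).1, (htab k).2]

open Polynomial in
/-- Roots that interlace points of equioscillation are translated Chebyshev roots. -/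
theorem sum_sq_sub_eq_of_interlacing {n : ℕ} (hn : 2 ≤ n) {x : Fin n → ℝ} {c : ℝ}
    {t : Fin (n + 1) → ℝ} (hlt : ∀ i, t i.castSucc < x i) (hgt : ∀ i, x i < t i.succ)
    (hR : ∀ k, |∏ i, (t k - x i)| = ((2 : ℝ) ^ (n - 1))⁻¹) (htc : ∀ k, |t k - c| ≤ 1) :
    ∑ i, (x i - c) ^ 2 = n / 2 := by
  have hpow : (2 : ℝ) ^ (n - 1) ≠ 0 := by positivity
  set P : ℝ[X] := C ((2 : ℝ) ^ (n - 1))⁻¹ * (Chebyshev.T ℝ n).comp (X - C c) with hP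
  have hnat : P.natDegree = n := by
    rw [hP, natDegree_C_mul (inv_ne_zero hpow), natDegree_comp, natDegree_X_sub_C,
      Chebyshev.natDegree_T, mul_one, Int.natAbs_natCast]
  have hlead : P.coeff n = 1 := by
    rw [← hnat, coeff_natDegree, hP, leadingCoeff_mul, leadingCoeff_C,
      leadingCoeff_comp (by simp)]
    simp
  have hPx := eq_prod_X_sub_C_of_interlacing hlt hgt hR
    (natDegree_le_iff_degree_le.1 hnat.le) hlead fun k ↦ by
      rw [hP, eval_mul, eval_C, eval_comp, abs_mul, abs_of_pos (by positivity)]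
      refine mul_le_of_le_one_right (by positivity) ?_
      exact Chebyshev.abs_eval_T_real_le_one _ (by simpa using htc k)
  have hT : Chebyshev.T ℝ n = C ((2 : ℝ) ^ (n - 1)) * ∏ i, (X - C (x i - c)) := by
    have := congrArg (fun q ↦ C ((2 : ℝ) ^ (n - 1)) * q.comp (X + C c)) hPx
    simp only [hP, mul_comp, C_comp, comp_assoc, sub_comp, X_comp, add_sub_cancel_right, comp_X,
      prod_comp, ← mul_assoc, ← C_mul, mul_inv_cancel₀ hpow, C_1, one_mul] at this
    rw [this]
    congr 1
    refine Finset.prod_congr rfl fun i _ ↦ ?_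
    rw [C_sub]
    ring
  have hroots : (Chebyshev.T ℝ n).roots = Finset.univ.val.map fun i ↦ x i - c := by
    rw [hT, roots_C_mul _ hpow]
    have := roots_multiset_prod_X_sub_C (Finset.univ.val.map fun i ↦ x i - c)
    rwa [Multiset.map_map] at this
  rw [Chebyshev.roots_T_real] at hroots
  have hinj := (Finset.range n).nodup_map_iff_injOn.mp (Chebyshev.roots_T_real_nodup n)
  rw [Finset.image_val_of_injOn hinj] at hroots
  have := congrArg (fun s : Multiset ℝ ↦ (s.map (· ^ 2)).sum) hroots
  simp only [Multiset.map_map, Function.comp_def] at this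
  exact this.symm.trans (sum_cos_sq_chebyshev_roots hn)

theorem IsCentredBounded.sum_sq_le {m : ℕ} (hm : 1 ≤ m) {x : Fin (m + 1) → ℝ}
    (hx : IsCentredBounded ((2 : ℝ) ^ m)⁻¹ x) : ∑ n, x n ^ 2 ≤ (m + 1) / 2 := by
  have hcompact := isCompact_setOf_isCentredBounded (ι := Fin (m + 1))
  rw [Fintype.card_fin, Nat.add_sub_cancel] at hcompact
  obtain ⟨w, hw, hmax⟩ := hcompact.exists_isMaxOn ⟨x, hx⟩
    (f := fun y ↦ ∑ n, y n ^ 2) (by fun_prop)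
  set y := w ∘ Tuple.sort w with hy
  have hsum : ∑ n, y n ^ 2 = ∑ n, w n ^ 2 := Equiv.sum_comp (Tuple.sort w) (fun n ↦ w n ^ 2)
  have hyb : IsCentredBounded ((2 : ℝ) ^ m)⁻¹ y := IsCentredBounded.comp_perm hw _
  have hmono : Monotone y := Tuple.monotone_sort w
  obtain ⟨c, t, hlt, hgt, hR, htc⟩ := hyb.exists_interlacing hmono fun k ↦ by
    by_contra! h
    obtain ⟨v, hv, hvlt⟩ := IsCentredBounded.exists_sum_sq_lt hyb k.castSucc_lt_succ.ne
      (hmono k.castSucc_lt_succ.le) h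
    exact (hvlt.trans_le (hmax hv)).ne hsum
  have hsq := sum_sq_sub_eq_of_interlacing (by omega) hlt hgt hR htc
  push_cast at hsq
  have hexpand : ∑ n, (y n - c) ^ 2 = ∑ n, y n ^ 2 + (m + 1) * c ^ 2 := by
    have (n : Fin (m + 1)) : (y n - c) ^ 2 = y n ^ 2 - 2 * c * y n + c ^ 2 := by ring
    simp_rw [this, Finset.sum_add_distrib, Finset.sum_sub_distrib, ← Finset.mul_sum, hyb.1]
    simp
  have hxw : ∑ n, x n ^ 2 ≤ ∑ n, w n ^ 2 := hmax hx
  have : 0 ≤ ((m : ℝ) + 1) * c ^ 2 := by positivity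
  linarith

theorem memP.sum_sq_le_of_pos {s : ℕ} (hs : 2 ≤ s) {r : ℝ} (hr : 0 < r) {x : Fin s → ℝ}
    (hx : memP s hs r x) :
    ∑ n, (x n) ^ 2 ≤ 2 * s * (r / 2) ^ ((2 : ℝ) / s) := by
  obtain ⟨m, rfl⟩ : ∃ m, s = m + 1 := ⟨s - 1, by omega⟩
  obtain ⟨hmono, hsum, hbound⟩ := hx
  set ρ : ℝ := (r / 2) ^ ((1 : ℝ) / (m + 1 : ℕ)) with hρ
  have hρpos : 0 < ρ := by positivity
  have hρpow : ρ ^ (m + 1) = r / 2 := by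
    rw [hρ, one_div, rpow_inv_natCast_pow (by positivity) (by omega)]
  have hρsq : (r / 2) ^ ((2 : ℝ) / (m + 1 : ℕ)) = ρ ^ 2 := by
    rw [hρ, ← rpow_mul_natCast (by positivity)]
    congr 1
    push_cast
    ring
  have hscaled : IsCentredBounded ((2 : ℝ) ^ m)⁻¹ fun n ↦ x n / (2 * ρ) := by
    refine ⟨by rw [← Finset.sum_div, hsum, zero_div], fun i j z hz ↦ ?_⟩
    have h1 := (div_le_iff₀ (by positivity)).1 hz.1
    have h2 := (le_div_iff₀ (by positivity)).1 hz.2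
    have := hbound (z * (2 * ρ))
      ⟨(hmono (Fin.le_def.2 (Nat.zero_le _))).trans h1,
        h2.trans (hmono (Fin.le_def.2 (Nat.le_sub_one_of_lt j.2)))⟩
    have hprod : ∏ n, (z * (2 * ρ) - x n) =
        (∏ n, (z - x n / (2 * ρ))) * (2 * ρ) ^ (m + 1) := by
      have : (2 * ρ) ^ (m + 1) = ∏ _n : Fin (m + 1), (2 * ρ) := by simp
      rw [this, ← Finset.prod_mul_distrib]
      exact Finset.prod_congr rfl fun n _ ↦ by field
    rw [hprod, abs_mul, mul_pow, hρpow, abs_of_pos (a := _ * (r / 2)) (by positivity)] at this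
    rw [← one_div, le_div_iff₀ (by positivity)]
    refine le_of_mul_le_mul_right ?_ hr
    rw [pow_succ] at this
    linarith
  have := hscaled.sum_sq_le (by omega)
  simp only [div_pow] at this
  rw [← Finset.sum_div, div_le_iff₀ (by positivity)] at this
  rw [hρsq]
  push_cast
  linarith

/-- For every `x = (x_1, …, x_s) ∈ 𝒫_s(r)`, one has
`∑_{n=1}^s x_n² ≤ 2s (r/2)^{2/s}`. -/
theorem stmt13 (s : ℕ) (hs : 2 ≤ s) (r : ℝ) (hr : 0 ≤ r) (x : Fin s → ℝ)
    (hx : memP s hs r x) :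
    ∑ n, (x n) ^ 2 ≤ 2 * s * (r / 2) ^ ((2 : ℝ) / s) := by
  refine ge_of_tendsto (f := fun r' : ℝ ↦ 2 * s * (r' / 2) ^ ((2 : ℝ) / s))
    (x := nhdsWithin r (Set.Ioi r)) ?_ ?_
  · refine (Continuous.tendsto ?_ r).mono_left nhdsWithin_le_nhds
    have := continuous_rpow_const (q := (2 : ℝ) / s) (by positivity)
    fun_prop
  · filter_upwards [self_mem_nhdsWithin] with r' hr'
    exact memP.sum_sq_le_of_pos hs (hr.trans_lt hr')
      ⟨hx.1, hx.2.1, fun z hz ↦ (hx.2.2 z hz).trans (le_of_lt hr')⟩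
end

section
/- Let s ≥ 2 be an integer and r ≥ 0. Define x_k = 2·(r/2)^{1/s}·cos(π(2(s−k)+1)/(2s)) for k = 1, …, s (the increasingly ordered zeros of the polynomial r·T_s(z·r^{-1/s}·2^{(1−s)/s}), where T_s is the s-th Chebyshev polynomial of the first kind). Then x = (x_1, …, x_s) belongs to 𝒫_s(r) and ∑_{k=1}^s x_k² = 2s·(r/2)^{2/s}; consequently, sup_{x ∈ 𝒫_s(r)} ∑_{n=1}^s x_n² = 2s·(r/2)^{2/s}. -/
open Real

open Polynomial Filter Topology

/-- Unordered version of `memP`. -/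
def IsAdmissible {s : ℕ} (r : ℝ) (x : Fin s → ℝ) : Prop :=
  ∑ n, x n = 0 ∧ ∀ i j, ∀ t ∈ Set.Icc (0 : ℝ) 1,
    |∏ n, ((1 - t) * x i + t * x j - x n)| ≤ r

lemma IsAdmissible.abs_prod_le {s : ℕ} {r : ℝ} {x : Fin s → ℝ} (hx : IsAdmissible r x)
    {a b : Fin s} {z : ℝ} (ha : x a ≤ z) (hb : z ≤ x b) : |∏ n, (z - x n)| ≤ r := by
  have hz : z ∈ segment ℝ (x a) (x b) := by
    rw [segment_eq_Icc (ha.trans hb)]; exact ⟨ha, hb⟩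
  obtain ⟨u, v, hu, hv, huv, rfl⟩ := hz
  have := hx.2 a b v ⟨hv, by linarith⟩
  rw [← huv, add_sub_cancel_right] at this
  simpa using this

lemma two_mul_half_pow_le {s : ℕ} (hs : s ≠ 0) {r c h : ℝ} (hr : 0 < r) (hh : 0 ≤ h)
    (x : Fin s → ℝ) (hx : ∀ z ∈ Set.Icc (c - h) (c + h), |∏ n, (z - x n)| ≤ r) :
    2 * (h / 2) ^ s ≤ r := by
  rcases hh.eq_or_lt with rfl | hh
  · simp [hs, hr.le]
  set Q : ℝ[X] := C (1 / r) * ∏ n, (C h * X + C (c - x n)) with hQ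
  have hlead : Q.leadingCoeff = 1 / r * h ^ s := by
    simp only [hQ, leadingCoeff_mul, leadingCoeff_C, leadingCoeff_prod,
      leadingCoeff_linear hh.ne']
    simp
  have hdeg : Q.degree ≤ s := by
    rw [hQ, degree_C_mul (by positivity)]
    refine (degree_prod_le _ _).trans ?_
    refine (Finset.sum_le_sum fun n _ => degree_linear_le).trans ?_
    simp
  have hb : ∀ t ∈ Set.Icc (-1 : ℝ) 1, |Q.eval t| ≤ 1 := by
    intro t ht
    have h1 := hx (h * t + c) ⟨by nlinarith [ht.1], by nlinarith [ht.2]⟩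
    have : Q.eval t = 1 / r * ∏ n, (h * t + c - x n) := by
      simp only [hQ, eval_mul, eval_C, eval_prod, eval_add, eval_X]
      congr 1
      exact Finset.prod_congr rfl fun n _ => by ring
    rw [this, abs_mul, abs_of_pos (by positivity), one_div, inv_mul_le_iff₀ hr, mul_one]
    exact h1
  have := Polynomial.Chebyshev.leadingCoeff_le_of_forall_abs_le_one hdeg hb
  rw [hlead, one_div, inv_mul_le_iff₀ hr] at this
  obtain ⟨m, rfl⟩ := Nat.exists_eq_succ_of_ne_zero hs
  simp only [Nat.succ_eq_add_one, Nat.add_sub_cancel] at this ⊢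
  rw [div_pow, pow_succ 2 m, mul_div_assoc', div_le_iff₀ (by positivity)]
  linarith

/-- First-order perturbation of the roots. -/
lemma IsAdmissible.exists_sum_sq_lt {s : ℕ} {r : ℝ} {x : Fin s → ℝ} (hr : 0 < r)
    (hx : IsAdmissible r x) {d : Fin s → ℝ} (hd : ∑ n, d n = 0) (hd0 : d ≠ 0)
    (hxd : 0 ≤ ∑ n, x n * d n)
    (hact : ∀ z a b, |∏ n, (z - x n)| = r → x a < z → z < x b →
      ∀ᶠ w in 𝓝 z, 0 ≤ ∑ n, d n / (w - x n)) :
    ∃ y : Fin s → ℝ, IsAdmissible r y ∧ ∑ n, x n ^ 2 < ∑ n, y n ^ 2 := by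
  have key : ∀ i j, ∀ᶠ e : ℝ in 𝓝 0, ∀ t ∈ Set.Icc (0 : ℝ) 1, 0 < e →
      |∏ n, ((1 - t) * (x i + e * d i) + t * (x j + e * d j) - (x n + e * d n))| ≤ r := by
    intro i j
    apply isCompact_Icc.eventually_forall_of_forall_eventually
    intro t ht
    set z : ℝ × ℝ → ℝ := fun q => (1 - q.2) * (x i + q.1 * d i) + q.2 * (x j + q.1 * d j) with hz
    have hzc : Continuous z := by fun_prop
    have hz0 : z (0, t) = (1 - t) * x i + t * x j := by simp [hz]
    have hle := hx.2 i j t ht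
    rw [← hz0] at hle
    rcases hle.lt_or_eq with hlt | heq
    · have hc : ContinuousAt (fun q : ℝ × ℝ => |∏ n, (z q - (x n + q.1 * d n))|) (0, t) := by
        fun_prop
      have h2 := hc.eventually_lt (continuousAt_const (y := r)) (by simpa using hlt)
      filter_upwards [h2] with q hq _ using hq.le
    · have hne : ∀ n, z (0, t) - x n ≠ 0 := by
        intro n hn
        rw [Finset.prod_eq_zero (Finset.mem_univ n) hn, abs_zero] at heq
        exact hr.ne heq
      have hab : ∃ a b, x a < z (0, t) ∧ z (0, t) < x b := by
        have hi := hne i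
        have hj := hne j
        rw [hz0] at hi hj ⊢
        rcases le_total (x i) (x j) with hij | hij
        · refine ⟨i, j, lt_of_le_of_ne (by nlinarith [ht.1, ht.2]) (sub_ne_zero.1 hi).symm,
            lt_of_le_of_ne (by nlinarith [ht.1, ht.2]) (sub_ne_zero.1 hj)⟩
        · refine ⟨j, i, lt_of_le_of_ne (by nlinarith [ht.1, ht.2]) (sub_ne_zero.1 hj).symm,
            lt_of_le_of_ne (by nlinarith [ht.1, ht.2]) (sub_ne_zero.1 hi)⟩
      obtain ⟨a, b, ha, hb⟩ := hab
      have e1 := hzc.continuousAt.eventually (hact _ a b heq ha hb)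
      have e2 : ∀ᶠ q in 𝓝 ((0 : ℝ), t), x a < z q :=
        (continuousAt_const).eventually_lt hzc.continuousAt ha
      have e3 : ∀ᶠ q in 𝓝 ((0 : ℝ), t), z q < x b :=
        hzc.continuousAt.eventually_lt continuousAt_const hb
      have e4 : ∀ᶠ q in 𝓝 ((0 : ℝ), t), ∀ n, z q - x n ≠ 0 :=
        eventually_all.2 fun n => (by fun_prop : ContinuousAt (fun q => z q - x n) (0, t)).eventually_ne
          (hne n)
      have e5 : ∀ᶠ q in 𝓝 ((0 : ℝ), t), ∀ n, q.1 * (d n / (z q - x n)) < 1 := by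
        refine eventually_all.2 fun n => ?_
        have hc : ContinuousAt (fun q : ℝ × ℝ => q.1 * (d n / (z q - x n))) (0, t) := by
          refine continuousAt_fst.mul (continuousAt_const.div ?_ (hne n))
          fun_prop
        exact hc.eventually_lt continuousAt_const (by simp)
      filter_upwards [e1, e2, e3, e4, e5] with q h1 h2 h3 h4 h5 hq
      have hle := hx.abs_prod_le h2.le h3.le
      have hprod : ∏ n, (z q - (x n + q.1 * d n)) =
          (∏ n, (z q - x n)) * ∏ n, (1 - q.1 * (d n / (z q - x n))) := by
        rw [← Finset.prod_mul_distrib]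
        refine Finset.prod_congr rfl fun n _ => ?_
        have := h4 n
        field_simp
        ring
      have hnn : 0 ≤ ∏ n, (1 - q.1 * (d n / (z q - x n))) :=
        Finset.prod_nonneg fun n _ => by linarith [h5 n]
      have hle1 : ∏ n, (1 - q.1 * (d n / (z q - x n))) ≤ 1 := by
        calc _ ≤ ∏ n, Real.exp (-(q.1 * (d n / (z q - x n)))) :=
              Finset.prod_le_prod (fun n _ => by linarith [h5 n])
                (fun n _ => Real.one_sub_le_exp_neg _)
          _ = Real.exp (-(q.1 * ∑ n, d n / (z q - x n))) := by
              rw [← Real.exp_sum, Finset.sum_neg_distrib, Finset.mul_sum]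
          _ ≤ 1 := Real.exp_le_one_iff.2 (by nlinarith)
      change |∏ n, (z q - (x n + q.1 * d n))| ≤ r
      rw [hprod, abs_mul, abs_of_nonneg hnn]
      nlinarith [abs_nonneg (∏ n, (z q - x n))]
  have hall : ∀ᶠ e : ℝ in 𝓝[>] 0, ∀ i j, ∀ t ∈ Set.Icc (0 : ℝ) 1, 0 < e →
      |∏ n, ((1 - t) * (x i + e * d i) + t * (x j + e * d j) - (x n + e * d n))| ≤ r :=
    nhdsWithin_le_nhds (eventually_all.2 fun i => eventually_all.2 fun j => key i j)
  obtain ⟨e, he, hepos⟩ := (hall.and self_mem_nhdsWithin).exists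
  have hepos : 0 < e := hepos
  refine ⟨fun n => x n + e * d n, ⟨?_, fun i j t ht => he i j t ht hepos⟩, ?_⟩
  · rw [Finset.sum_add_distrib, ← Finset.mul_sum, hx.1, hd]; simp
  · have h1 : ∑ n, (x n + e * d n) ^ 2 =
        ∑ n, x n ^ 2 + 2 * e * ∑ n, x n * d n + e ^ 2 * ∑ n, d n ^ 2 := by
      rw [Finset.mul_sum, Finset.mul_sum, ← Finset.sum_add_distrib, ← Finset.sum_add_distrib]
      exact Finset.sum_congr rfl fun n _ => by ring
    have h2 : 0 < ∑ n, d n ^ 2 := by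
      obtain ⟨n, hn⟩ := Function.ne_iff.1 hd0
      exact Finset.sum_pos' (fun n _ => sq_nonneg _) ⟨n, Finset.mem_univ n, by
        have : d n ≠ 0 := hn
        positivity⟩
    rw [h1]
    have : 0 < e ^ 2 * ∑ n, d n ^ 2 := by positivity
    have : 0 ≤ 2 * e * ∑ n, x n * d n := by positivity
    linarith

lemma hasDerivAt_prod_sub {s : ℕ} (x : Fin s → ℝ) {z : ℝ} (hz : ∏ n, (z - x n) ≠ 0) :
    HasDerivAt (fun w => ∏ n, (w - x n)) ((∏ n, (z - x n)) * ∑ n, 1 / (z - x n)) z := by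
  have h := HasDerivAt.fun_finsetProd (u := Finset.univ) (f := fun (n : Fin s) w => w - x n)
    (f' := fun _ => 1) (x := z) (fun n _ => (hasDerivAt_id z).sub_const (x n))
  convert! h using 1
  rw [Finset.mul_sum]
  refine Finset.sum_congr rfl fun n _ => ?_
  have hn : z - x n ≠ 0 := Finset.prod_ne_zero_iff.1 hz n (Finset.mem_univ n)
  rw [← Finset.mul_prod_erase _ _ (Finset.mem_univ n)]
  simp
  field_simp

lemma IsAdmissible.sum_inv_eq_zero {s : ℕ} {r : ℝ} {x : Fin s → ℝ} (hr : 0 < r)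
    (hx : IsAdmissible r x) {z : ℝ} {a b : Fin s} (hz : |∏ n, (z - x n)| = r)
    (ha : x a < z) (hb : z < x b) : ∑ n, 1 / (z - x n) = 0 := by
  have hne : ∏ n, (z - x n) ≠ 0 := by
    intro h; rw [h, abs_zero] at hz; exact hr.ne hz
  have hd := (hasDerivAt_prod_sub x hne).pow 2
  have hmax : IsLocalMax ((fun w => ∏ n, (w - x n)) ^ 2) z := by
    filter_upwards [Ioo_mem_nhds ha hb] with w hw
    simp only [Pi.pow_apply]
    rw [← sq_abs, ← sq_abs (∏ n, (z - x n)), hz]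
    exact pow_le_pow_left₀ (abs_nonneg _) (hx.abs_prod_le hw.1.le hw.2.le) 2
  have := hmax.hasDerivAt_eq_zero hd
  simpa [hne] using this

lemma IsAdmissible.abs_prod_eq_of_critical {s : ℕ} (hs : s ≠ 0) {r : ℝ} {x : Fin s → ℝ} (hr : 0 < r)
    (hx : IsAdmissible r x)
    (hmax : ∀ y : Fin s → ℝ, IsAdmissible r y → ∑ n, y n ^ 2 ≤ ∑ n, x n ^ 2)
    {ξ : ℝ} (hξ : ∏ n, (ξ - x n) ≠ 0) (hcrit : ∑ n, 1 / (ξ - x n) = 0) :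
    |∏ n, (ξ - x n)| = r := by
  by_contra hne
  have hs' : (0 : ℝ) < s := by positivity
  have hξn : ∀ n, x n - ξ ≠ 0 := fun n => by
    have := Finset.prod_ne_zero_iff.1 hξ n (Finset.mem_univ n)
    contrapose! this; linarith
  have hcrit' : ∑ n, 1 / (x n - ξ) = 0 := by
    have : ∑ n, 1 / (x n - ξ) = - ∑ n, 1 / (ξ - x n) := by
      rw [← Finset.sum_neg_distrib]
      exact Finset.sum_congr rfl fun n _ => by rw [← neg_sub, one_div_neg_eq_neg_one_div]
    rw [this, hcrit, neg_zero]
  set S := ∑ n, x n ^ 2 with hS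
  have hS0 : 0 ≤ S := Finset.sum_nonneg fun n _ => sq_nonneg _
  set η : ℝ := 1 / (2 * (S + 1)) with hη
  have hη0 : 0 < η := by positivity
  set d : Fin s → ℝ := fun n => 1 / (x n - ξ) - η * x n with hd
  have hd1 : ∑ n, d n = 0 := by
    simp only [hd]
    rw [Finset.sum_sub_distrib, ← Finset.mul_sum, hx.1, hcrit']; simp
  have hxd : ∑ n, x n * d n = s - η * S := by
    have : ∀ n, x n * d n = 1 + ξ * (1 / (x n - ξ)) - η * x n ^ 2 := fun n => by
      have := hξn n
      simp only [hd]; field_simp; ring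
    simp_rw [this]
    rw [Finset.sum_sub_distrib, Finset.sum_add_distrib, ← Finset.mul_sum, ← Finset.mul_sum, hcrit']
    simp [hS]
  have hpos : 0 < ∑ n, x n * d n := by
    rw [hxd]
    have h1 : (1 : ℝ) ≤ s := by exact_mod_cast Nat.one_le_iff_ne_zero.2 hs
    have : η * S < 1 := by
      rw [hη, one_div, inv_mul_lt_iff₀ (by positivity)]; linarith
    linarith
  have hd0 : d ≠ 0 := by
    intro h; rw [h] at hpos; simp at hpos
  obtain ⟨y, hy, hlt⟩ := hx.exists_sum_sq_lt hr hd1 hd0 hpos.le (by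
    intro z a b hz ha hb
    have hc := hx.sum_inv_eq_zero hr hz ha hb
    have hzn : ∀ n, z - x n ≠ 0 := fun n hn => by
      rw [Finset.prod_eq_zero (Finset.mem_univ n) hn, abs_zero] at hz
      exact hr.ne hz
    have hzξ : z - ξ ≠ 0 := fun h => hne (by rw [← sub_eq_zero.1 h]; exact hz)
    have hval : ∑ n, d n / (z - x n) = η * s := by
      have : ∀ n, d n / (z - x n) = 1 / (z - ξ) * (1 / (x n - ξ)) + 1 / (z - ξ) * (1 / (z - x n))
          + η - η * z * (1 / (z - x n)) := fun n => by
        have h1 := hξn n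
        have h2 := hzn n
        simp only [hd]; field_simp; ring
      simp_rw [this]
      rw [Finset.sum_sub_distrib, Finset.sum_add_distrib, Finset.sum_add_distrib,
        ← Finset.mul_sum, ← Finset.mul_sum, ← Finset.mul_sum, hc, hcrit']
      simp [mul_comm]
    have hcont : ContinuousAt (fun w => ∑ n, d n / (w - x n)) z := by
      refine tendsto_finsetSum _ fun n _ => ?_
      exact (continuousAt_const.div (by fun_prop) (hzn n))
    refine ((continuousAt_const (y := (0 : ℝ))).eventually_lt hcont ?_).mono fun _ h => h.le
    rw [hval]; positivity)
  exact (hmax y hy).not_gt hlt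

lemma IsAdmissible.injective_of_isMax {s : ℕ} {r : ℝ} {x : Fin s → ℝ} (hr : 0 < r)
    (hx : IsAdmissible r x)
    (hmax : ∀ y : Fin s → ℝ, IsAdmissible r y → ∑ n, y n ^ 2 ≤ ∑ n, x n ^ 2) :
    Function.Injective x := by
  intro a b hab
  by_contra hne
  have hsum : ∀ f : Fin s → ℝ, ∑ n, f n * (Pi.single a 1 - Pi.single b 1 : Fin s → ℝ) n = f a - f b := by
    intro f
    simp [mul_sub, Finset.sum_sub_distrib, Pi.single_apply]
  obtain ⟨y, hy, hlt⟩ := hx.exists_sum_sq_lt hr (d := Pi.single a 1 - Pi.single b 1)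
    (by simp)
    (fun h => by simpa [Pi.single_apply, hne] using congrFun h a)
    (by rw [hsum, hab, sub_self])
    (fun z _ _ _ _ _ => Eventually.of_forall fun w => by
      have := hsum fun n => 1 / (w - x n)
      simp only [div_mul_eq_mul_div, one_mul, hab, sub_self] at this
      rw [this])
  exact (hmax y hy).not_gt hlt

lemma coeff_sq_of_natDegree_le {P : ℝ[X]} {d : ℕ} (hP : P.natDegree ≤ d + 2)
    (h1 : P.coeff (d + 1) = 0) :
    (P ^ 2).coeff (2 * d + 4) = P.coeff (d + 2) ^ 2 ∧ (P ^ 2).coeff (2 * d + 3) = 0 ∧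
      (P ^ 2).coeff (2 * d + 2) = 2 * P.coeff (d + 2) * P.coeff d := by
  set u := P.coeff (d + 2) with hu
  set v := P.coeff d with hv
  set R : ℝ[X] := P - C u * X ^ (d + 2) - C v * X ^ d with hR
  have hRc : ∀ k, d ≤ k → R.coeff k = 0 := by
    intro k hk
    simp only [hR, coeff_sub, coeff_C_mul, coeff_X_pow]
    rcases hk.eq_or_lt with rfl | hk
    · simp [hv]
    rcases (Nat.succ_le_of_lt hk).eq_or_lt with rfl | hk
    · simp [h1]
    rcases (Nat.succ_le_of_lt hk).eq_or_lt with rfl | hk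
    · simp [hu, show d + 1 + 1 ≠ d by omega]
    · rw [coeff_eq_zero_of_natDegree_lt (by omega), if_neg (by omega), if_neg (by omega)]
      simp
  set E : ℝ[X] := C (v ^ 2) * X ^ (2 * d) + (C (2 * u) * X ^ (d + 2) + C (2 * v) * X ^ d + R) * R
    with hE
  have hEc : ∀ k, 2 * d + 2 ≤ k → E.coeff k = 0 := by
    intro k hk
    have hz : ((C (2 * u) * X ^ (d + 2) + C (2 * v) * X ^ d + R) * R).coeff k = 0 := by
      by_cases hR0 : R = 0
      · rw [hR0, mul_zero, coeff_zero]
      have hRd : R.natDegree < d := by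
        by_contra! hcon
        exact hR0 (leadingCoeff_eq_zero.1 (hRc _ hcon))
      apply coeff_eq_zero_of_natDegree_lt
      refine lt_of_le_of_lt natDegree_mul_le ?_
      have : (C (2 * u) * X ^ (d + 2) + C (2 * v) * X ^ d + R).natDegree ≤ d + 2 := by
        refine natDegree_add_le_of_degree_le (natDegree_add_le_of_degree_le
          (natDegree_C_mul_X_pow_le _ _) ((natDegree_C_mul_X_pow_le _ _).trans (by omega)))
          (by omega)
      omega
    rw [hE, coeff_add, hz, coeff_C_mul, coeff_X_pow, if_neg (by omega)]
    simp
  have hsq : P ^ 2 = C (u ^ 2) * X ^ (2 * d + 4) + C (2 * u * v) * X ^ (2 * d + 2) + E := by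
    have : P = C u * X ^ (d + 2) + C v * X ^ d + R := by rw [hR]; ring
    rw [this, hE]
    simp only [C_mul, C_pow]
    have h2 : (C 2 : ℝ[X]) = 2 := rfl
    rw [h2]
    ring
  rw [hsq]
  simp only [coeff_add, coeff_C_mul, coeff_X_pow]
  rw [hEc _ (by omega), hEc _ (by omega), hEc _ (by omega)]
  simp

lemma coeff_prod_X_sub_C {ι : Type*} (x : ι → ℝ) (T : Finset ι) :
    (∏ n ∈ T, (X - C (x n))).coeff T.card = 1 ∧
    (∀ m, T.card = m + 1 → (∏ n ∈ T, (X - C (x n))).coeff m = -∑ n ∈ T, x n) ∧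
    (∀ m, T.card = m + 2 → 2 * (∏ n ∈ T, (X - C (x n))).coeff m =
      (∑ n ∈ T, x n) ^ 2 - ∑ n ∈ T, x n ^ 2) := by
  classical
  induction T using Finset.induction_on with
  | empty => simp
  | insert a T ha ih =>
    obtain ⟨h0, h1, h2⟩ := ih
    simp only [Finset.prod_insert ha, Finset.sum_insert ha, Finset.card_insert_of_notMem ha]
    set P := ∏ n ∈ T, (X - C (x n)) with hP
    have hdeg : P.natDegree = T.card := natDegree_finsetProd_X_sub_C_eq_card T x
    have hsucc : ∀ k, ((X - C (x a)) * P).coeff (k + 1) = P.coeff k - x a * P.coeff (k + 1) := by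
      intro k; rw [sub_mul, coeff_sub, coeff_X_mul, coeff_C_mul]
    have hzero : ((X - C (x a)) * P).coeff 0 = - x a * P.coeff 0 := by
      simp [sub_mul]
    refine ⟨?_, ?_, ?_⟩
    · rw [hsucc, h0, coeff_eq_zero_of_natDegree_lt (by omega)]; simp
    · rintro (_ | m) hm
      · have hT : T.card = 0 := by omega
        rw [hzero, ← hT, h0, Finset.card_eq_zero.1 hT]; simp
      · have hT : T.card = m + 1 := by omega
        rw [hsucc, h1 m hT, ← hT, h0]; ring
    · rintro (_ | m) hm
      · have hT : T.card = 1 := by omega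
        rw [hzero]
        obtain ⟨b, rfl⟩ := Finset.card_eq_one.1 hT
        rw [h1 0 hT]; simp; ring
      · have hT : T.card = m + 2 := by omega
        have := h2 m hT
        rw [hsucc, h1 (m + 1) hT, mul_sub, this]; ring

/-- A polynomial all of whose critical values are `±r` satisfies a Pell equation. -/
lemma exists_pell {s : ℕ} {r : ℝ} {x : Fin s → ℝ} (hinj : Function.Injective x)
    (hcrit : ∀ ξ, ∏ n, (ξ - x n) ≠ 0 → ∑ n, 1 / (ξ - x n) = 0 → |∏ n, (ξ - x n)| = r) :
    derivative (∏ n, (X - C (x n))) ^ 2 ∣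
      C ((s : ℝ) ^ 2) * ((∏ n, (X - C (x n))) ^ 2 - C (r ^ 2)) := by
  rcases Nat.eq_zero_or_pos s with rfl | hs
  · simp
  set P : ℝ[X] := ∏ n, (X - C (x n)) with hP
  have heval : ∀ z, P.eval z = ∏ n, (z - x n) := fun z => by simp [hP, eval_prod]
  have hmonic : P.Monic := monic_prod_X_sub_C _ _
  have hdeg : P.natDegree = s := by
    rw [hP, natDegree_finsetProd_X_sub_C_eq_card]; simp
  have hdeg' : P.derivative.natDegree = s - 1 := by
    rw [natDegree_derivative, hdeg]
  have hlead : P.derivative.leadingCoeff = s := by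
    rw [leadingCoeff, hdeg', coeff_derivative, Nat.sub_add_cancel hs, ← hdeg,
      hmonic.coeff_natDegree, hdeg, Nat.cast_sub hs]
    simp
  have hs0 : (s : ℝ) ≠ 0 := by positivity
  have hProots : P.roots.toFinset.card = s := by
    have : P = ∏ a ∈ Finset.univ.map ⟨x, hinj⟩, (X - C a) := by simp [hP]
    rw [this, roots_prod_X_sub_C, Finset.val_toFinset]; simp
  have hR := card_roots_toFinset_le_derivative P
  have hR2 := P.derivative.roots.toFinset_card_le
  have hR3 := P.derivative.card_roots'
  have hcard : P.derivative.roots.card = P.derivative.natDegree := by omega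
  have hnodup : P.derivative.roots.Nodup := by
    rw [← Multiset.toFinset_card_eq_card_iff_nodup]; omega
  have hfac : C (s : ℝ) * ∏ ξ ∈ P.derivative.roots.toFinset, (X - C ξ) = P.derivative := by
    rw [← hlead, Finset.prod, Multiset.toFinset_val, Multiset.dedup_eq_self.2 hnodup]
    exact C_leadingCoeff_mul_prod_multiset_X_sub_C hcard
  rw [← hfac, mul_pow, ← C_pow, ← Finset.prod_pow]
  refine mul_dvd_mul_left _ (Finset.prod_dvd_of_coprime ?_ ?_)
  · intro a _ b _ hab
    exact (pairwise_coprime_X_sub_C Function.injective_id hab).pow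
  · intro ξ hξ
    have hroot : P.derivative.eval ξ = 0 := by
      have := Multiset.mem_toFinset.1 hξ
      exact (mem_roots'.1 this).2
    have hsep : P.Separable := separable_prod_X_sub_C_iff.2 hinj
    have hne : P.eval ξ ≠ 0 := fun h0 => by
      have := hsep.eval₂_derivative_ne_zero (RingHom.id ℝ) (x := ξ) (by simpa using h0)
      exact this (by simpa using hroot)
    have hne' := hne
    rw [heval] at hne'
    have hder : (∏ n, (ξ - x n)) * ∑ n, 1 / (ξ - x n) = 0 := by
      have h := P.hasDerivAt ξ
      simp only [heval, hroot] at h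
      exact (hasDerivAt_prod_sub x hne').unique h
    have habs := hcrit ξ hne' ((mul_eq_zero.1 hder).resolve_left hne')
    have hsq : P.eval ξ ^ 2 = r ^ 2 := by rw [heval, ← habs, sq_abs]
    by_cases hW : P ^ 2 - C (r ^ 2) = 0
    · rw [hW]; exact dvd_zero _
    · refine (le_rootMultiplicity_iff hW).1 ((one_lt_rootMultiplicity_iff_isRoot hW).2 ⟨?_, ?_⟩)
      · simp [IsRoot, hsq]
      · simp [IsRoot, derivative_pow, hroot]

lemma eq_of_pell {s : ℕ} (hs : 2 ≤ s) {r : ℝ} {x : Fin s → ℝ} (hx : ∑ n, x n = 0)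
    (hinj : Function.Injective x)
    (hcrit : ∀ ξ, ∏ n, (ξ - x n) ≠ 0 → ∑ n, 1 / (ξ - x n) = 0 → |∏ n, (ξ - x n)| = r) :
    ∃ p' : ℝ → ℝ, ∀ z, (s : ℝ) ^ 2 * ((∏ n, (z - x n)) ^ 2 - r ^ 2) =
      p' z ^ 2 * (z ^ 2 - 2 * (∑ n, x n ^ 2) / s) := by
  obtain ⟨q, hq⟩ := exists_pell hinj hcrit
  set P : ℝ[X] := ∏ n, (X - C (x n)) with hP
  obtain ⟨m, rfl⟩ := Nat.exists_eq_add_of_le' hs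
  have heval : ∀ z, P.eval z = ∏ n, (z - x n) := fun z => by simp [hP, eval_prod]
  have hdeg : P.natDegree = m + 2 := by
    rw [hP, natDegree_finsetProd_X_sub_C_eq_card]; simp
  obtain ⟨c0, c1, c2⟩ := coeff_prod_X_sub_C x Finset.univ
  have c1 := c1 (m + 1) (by simp)
  have c2 := c2 m (by simp)
  simp only [Finset.card_univ, Fintype.card_fin, hx, ← hP, neg_zero] at c0 c1 c2
  set S := ∑ n, x n ^ 2 with hS
  set D : ℝ[X] := X * P.derivative with hD
  have hDc : ∀ k, D.coeff k = k * P.coeff k := by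
    rintro (_ | k)
    · simp [hD]
    · rw [hD, coeff_X_mul, coeff_derivative]; push_cast; ring
  have hDdeg : D.natDegree ≤ m + 2 := by
    rw [natDegree_le_iff_coeff_eq_zero]
    intro k hk
    rw [hDc, coeff_eq_zero_of_natDegree_lt (by omega), mul_zero]
  obtain ⟨p4, p3, p2⟩ := coeff_sq_of_natDegree_le hdeg.le c1
  obtain ⟨d4, d3, d2⟩ := coeff_sq_of_natDegree_le hDdeg (by rw [hDc, c1, mul_zero])
  simp only [hDc, c0] at p4 p2 d4 d2
  have d5 : (D ^ 2).coeff (2 * m + 5) = 0 :=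
    coeff_eq_zero_of_natDegree_lt (lt_of_le_of_lt natDegree_pow_le (by omega))
  have hid : X ^ 2 * (C (((m + 2 : ℕ) : ℝ) ^ 2) * (P ^ 2 - C (r ^ 2))) = D ^ 2 * q := by
    rw [hq, hD]; ring
  have hm0 : ((m + 2 : ℕ) : ℝ) ≠ 0 := by positivity
  have hD'0 : P.derivative ≠ 0 := fun h => by
    have := hDc (m + 2)
    rw [hD, h, mul_zero, coeff_zero, c0, mul_one] at this
    exact hm0 this.symm
  have hqdeg : q.natDegree ≤ 2 := by
    by_cases hq0 : q = 0
    · simp [hq0]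
    have h1 : (P.derivative ^ 2 * q).natDegree ≤ 2 * (m + 2) := by
      rw [← hq]
      refine (natDegree_C_mul_le _ _).trans (natDegree_sub_C.le.trans ?_)
      rw [natDegree_pow, hdeg]
    rw [natDegree_mul (pow_ne_zero 2 hD'0) hq0, natDegree_pow, natDegree_derivative, hdeg] at h1
    omega
  have hqform : q = C (q.coeff 0) + C (q.coeff 1) * X + C (q.coeff 2) * X ^ 2 := by
    have := q.as_sum_range_C_mul_X_pow' (n := 3) (by omega)
    simpa [Finset.sum_range_succ] using this
  set q0 := q.coeff 0
  set q1 := q.coeff 1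
  set q2 := q.coeff 2
  have hcoeff : ∀ k, ((m + 2 : ℕ) : ℝ) ^ 2 * ((P ^ 2).coeff (k + 2) - (C (r ^ 2)).coeff (k + 2)) =
      (D ^ 2).coeff (k + 4) * q0 + (D ^ 2).coeff (k + 3) * q1 + (D ^ 2).coeff (k + 2) * q2 := by
    intro k
    have := congrArg (fun p => coeff p (k + 4)) hid
    beta_reduce at this
    rw [hqform, show k + 4 = (k + 2) + 2 by omega, coeff_X_pow_mul, coeff_C_mul, coeff_sub] at this
    rw [this, mul_add, mul_add, coeff_add, coeff_add, coeff_mul_C, ← mul_assoc, ← mul_assoc,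
      coeff_mul_X_pow, coeff_mul_C, coeff_mul_X, coeff_mul_C]
  have hC : ∀ k, (C (r ^ 2) : ℝ[X]).coeff (k + 2) = 0 := fun k => coeff_C_succ
  have e0 := hcoeff (2 * m + 2)
  have e1 := hcoeff (2 * m + 1)
  have e2 := hcoeff (2 * m)
  simp only [hC, Nat.add_assoc, Nat.reduceAdd] at e0 e1 e2
  have d6 : (D ^ 2).coeff (2 * m + 6) = 0 :=
    coeff_eq_zero_of_natDegree_lt (lt_of_le_of_lt natDegree_pow_le (by omega))
  rw [p4, d4, d5, d6] at e0
  rw [p3, d3, d4, d5] at e1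
  rw [p2, d2, d3, d4] at e2
  have hs2 : ((m + 2 : ℕ) : ℝ) ^ 2 ≠ 0 := pow_ne_zero 2 hm0
  have hq2 : q2 = 1 := by
    apply mul_left_cancel₀ hs2; linear_combination -e0
  have hq1 : q1 = 0 := by
    apply mul_left_cancel₀ hs2; linear_combination -e1
  have hq0 : q0 = - (2 * S / (m + 2 : ℕ)) := by
    apply mul_left_cancel₀ hs2
    rw [hq2] at e2
    have : ((m + 2 : ℕ) : ℝ) ^ 2 * -(2 * S / (m + 2 : ℕ)) = - 2 * (m + 2 : ℕ) * S := by field_simp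
    rw [this]
    push_cast at e2 ⊢
    linear_combination -e2 + 2 * ((m : ℝ) + 2) * c2
  refine ⟨fun z => P.derivative.eval z, fun z => ?_⟩
  have := congrArg (eval z) hq
  rw [hqform, hq0, hq1, hq2] at this
  simp only [eval_mul, eval_C, eval_sub, eval_pow, eval_add, eval_X, heval] at this
  rw [this]; ring

lemma rpow_two_div {s : ℕ} {a : ℝ} (ha : 0 ≤ a) :
    a ^ ((2 : ℝ) / s) = (a ^ ((1 : ℝ) / s)) ^ 2 := by
  rw [← Real.rpow_natCast, ← Real.rpow_mul ha]; congr 1; push_cast; ring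

lemma le_rpow_of_pow_le {s : ℕ} (hs : s ≠ 0) {a b : ℝ} (ha : 0 ≤ a) (h : a ^ s ≤ b) :
    a ≤ b ^ ((1 : ℝ) / s) := by
  rw [one_div]
  exact (Real.le_rpow_inv_iff_of_pos ha ((pow_nonneg ha s).trans h) (by positivity)).2
    (by rwa [Real.rpow_natCast])

lemma IsAdmissible.sum_sq_le_of_isMax {s : ℕ} (hs : 2 ≤ s) {r : ℝ} {x : Fin s → ℝ} (hr : 0 < r)
    (hx : IsAdmissible r x)
    (hmax : ∀ y : Fin s → ℝ, IsAdmissible r y → ∑ n, y n ^ 2 ≤ ∑ n, x n ^ 2) :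
    ∑ n, x n ^ 2 ≤ 2 * s * (r / 2) ^ ((2 : ℝ) / s) := by
  have hs0 : s ≠ 0 := by omega
  have hsp : (0 : ℝ) < s := by positivity
  obtain ⟨p', hp'⟩ := eq_of_pell hs hx.1 (hx.injective_of_isMax hr hmax)
    (fun ξ => hx.abs_prod_eq_of_critical hs0 hr hmax)
  set S := ∑ n, x n ^ 2 with hS
  have hS0 : 0 ≤ S := Finset.sum_nonneg fun n _ => sq_nonneg _
  have hh2 : √(2 * S / s) ^ 2 = 2 * S / s := Real.sq_sqrt (by positivity)
  set h := √(2 * S / s) with hh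
  have hh0 : 0 ≤ h := Real.sqrt_nonneg _
  have hb := two_mul_half_pow_le hs0 (c := 0) hr hh0 x (by
    intro z hz
    have h1 := hp' z
    have h2 : z ^ 2 ≤ h ^ 2 := sq_le_sq' (by linarith [hz.1]) (by linarith [hz.2])
    rw [← hh2] at h1
    have h3 : (s : ℝ) ^ 2 * ((∏ n, (z - x n)) ^ 2 - r ^ 2) ≤ 0 := by
      rw [h1]; exact mul_nonpos_of_nonneg_of_nonpos (sq_nonneg _) (by linarith)
    have h4 : (∏ n, (z - x n)) ^ 2 ≤ r ^ 2 := by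
      by_contra! hcon
      have : 0 < (s : ℝ) ^ 2 * ((∏ n, (z - x n)) ^ 2 - r ^ 2) :=
        mul_pos (by positivity) (by linarith)
      linarith
    exact abs_le_of_sq_le_sq h4 hr.le)
  have hle : h / 2 ≤ (r / 2) ^ ((1 : ℝ) / s) := le_rpow_of_pow_le hs0 (by positivity) (by linarith)
  rw [rpow_two_div (by positivity)]
  have hpow := pow_le_pow_left₀ (by positivity) hle 2
  have : S = 2 * s * (h / 2) ^ 2 := by rw [div_pow, hh2]; field_simp
  rw [this]
  gcongr

lemma IsAdmissible.abs_le {s : ℕ} (hs : s ≠ 0) {r : ℝ} (hr : 0 < r) {x : Fin s → ℝ}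
    (hx : IsAdmissible r x) (n : Fin s) : |x n| ≤ 4 * (r / 2) ^ ((1 : ℝ) / s) := by
  have key : ∀ a b, x b - x a ≤ 4 * (r / 2) ^ ((1 : ℝ) / s) := by
    intro a b
    rcases le_total (x b) (x a) with h | h
    · have : 0 ≤ 4 * (r / 2) ^ ((1 : ℝ) / s) := by positivity
      linarith
    have hb := two_mul_half_pow_le hs (c := (x a + x b) / 2) (h := (x b - x a) / 2) hr
      (by linarith) x (fun z hz => hx.abs_prod_le (a := a) (b := b) (by linarith [hz.1])
        (by linarith [hz.2]))
    have := le_rpow_of_pow_le hs (a := (x b - x a) / 2 / 2) (b := r / 2) (by linarith) (by linarith)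
    linarith
  have hne : (Finset.univ : Finset (Fin s)).Nonempty := ⟨n, Finset.mem_univ n⟩
  obtain ⟨a, _, ha⟩ := Finset.exists_le_of_sum_le hne (f := x) (g := fun _ => 0)
    (by simp [hx.1])
  obtain ⟨b, _, hb⟩ := Finset.exists_le_of_sum_le hne (f := fun _ => (0 : ℝ)) (g := x)
    (by simp [hx.1])
  exact _root_.abs_le.2 ⟨by linarith [key n b], by linarith [key a n]⟩

lemma isCompact_setOf_isAdmissible {s : ℕ} (hs : s ≠ 0) {r : ℝ} (hr : 0 < r) :
    IsCompact {x : Fin s → ℝ | IsAdmissible r x} := by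
  refine Metric.isCompact_of_isClosed_isBounded ?_ ?_
  · simp only [IsAdmissible, Set.ofPred_and, Set.ofPred_forall]
    refine (isClosed_eq (by fun_prop) continuous_const).inter ?_
    exact isClosed_iInter fun i => isClosed_iInter fun j => isClosed_iInter fun t =>
      isClosed_iInter fun _ => isClosed_le (by fun_prop) continuous_const
  · refine (Metric.isBounded_closedBall (x := 0) (r := 4 * (r / 2) ^ ((1 : ℝ) / s))).subset ?_
    intro x hx
    rw [mem_closedBall_zero_iff, pi_norm_le_iff_of_nonneg (by positivity)]
    exact fun n => IsAdmissible.abs_le hs hr hx n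

lemma IsAdmissible.sum_sq_le {s : ℕ} (hs : 2 ≤ s) {r : ℝ} {x : Fin s → ℝ} (hr : 0 < r)
    (hx : IsAdmissible r x) : ∑ n, x n ^ 2 ≤ 2 * s * (r / 2) ^ ((2 : ℝ) / s) := by
  obtain ⟨y, hy, hmax⟩ := (isCompact_setOf_isAdmissible (by omega) hr).exists_isMaxOn ⟨x, hx⟩
    (f := fun x : Fin s → ℝ => ∑ n, x n ^ 2) (by fun_prop)
  exact (hmax hx).trans (IsAdmissible.sum_sq_le_of_isMax hs hr hy fun z hz => hmax hz)

lemma sum_range_cos_odd_mul {s : ℕ} {φ : ℝ} (h0 : Real.sin φ ≠ 0)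
    (h1 : Real.sin (2 * s * φ) = 0) : ∑ j ∈ Finset.range s, Real.cos ((2 * j + 1) * φ) = 0 := by
  have key : ∀ k : ℕ, 2 * Real.sin φ * ∑ j ∈ Finset.range k, Real.cos ((2 * j + 1) * φ) =
      Real.sin (2 * k * φ) := by
    intro k
    induction k with
    | zero => simp
    | succ k ih =>
      rw [Finset.sum_range_succ, mul_add, ih]
      have e1 : 2 * (k : ℝ) * φ = (2 * k + 1) * φ - φ := by ring
      have e2 : 2 * ((k + 1 : ℕ) : ℝ) * φ = (2 * k + 1) * φ + φ := by push_cast; ring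
      rw [e1, e2, Real.sin_sub, Real.sin_add]; ring
  have := key s
  rw [h1] at this
  simpa [h0] using this

lemma eval_chebyshev_T_eq_prod {s : ℕ} (y : ℝ) :
    (Polynomial.Chebyshev.T ℝ s).eval y =
      2 ^ (s - 1) * ∏ j ∈ Finset.range s, (y - Real.cos ((2 * j + 1) * π / (2 * s))) := by
  have hr := Polynomial.Chebyshev.roots_T_real s
  have hinj := (Finset.range s).nodup_map_iff_injOn.1 (Polynomial.Chebyshev.roots_T_real_nodup s)
  have hcard : (Polynomial.Chebyshev.T ℝ s).roots.card =
      (Polynomial.Chebyshev.T ℝ s).natDegree := by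
    rw [hr, Finset.card_val, Finset.card_image_of_injOn hinj]; simp
  have h := C_leadingCoeff_mul_prod_multiset_X_sub_C hcard
  rw [hr, Polynomial.Chebyshev.leadingCoeff_T, ← Finset.prod, Finset.prod_image hinj] at h
  rw [← h]
  simp [eval_prod]

lemma memP.isAdmissible {s : ℕ} {hs : 2 ≤ s} {r : ℝ} {x : Fin s → ℝ} (hx : memP s hs r x) :
    IsAdmissible r x := by
  obtain ⟨hmono, hsum, hbd⟩ := hx
  refine ⟨hsum, fun i j t ht => hbd _ ?_⟩
  have h0 : ∀ k : Fin s, x ⟨0, by omega⟩ ≤ x k := fun k => hmono (Fin.mk_le_of_le_val (Nat.zero_le _))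
  have h1 : ∀ k : Fin s, x k ≤ x ⟨s - 1, by omega⟩ := fun k =>
    hmono (Fin.mk_le_mk.2 (by omega : (k : ℕ) ≤ s - 1))
  exact (convex_Icc _ _) ⟨h0 i, h1 i⟩ ⟨h0 j, h1 j⟩ (by linarith [ht.2]) ht.1 (by ring)

lemma memP.sum_sq_le {s : ℕ} {hs : 2 ≤ s} {r : ℝ} (hr : 0 ≤ r) {x : Fin s → ℝ}
    (hx : memP s hs r x) : ∑ n, x n ^ 2 ≤ 2 * s * (r / 2) ^ ((2 : ℝ) / s) := by
  have hc : Tendsto (fun q : ℝ => 2 * s * (q / 2) ^ ((2 : ℝ) / s)) (𝓝[>] r)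
      (𝓝 (2 * s * (r / 2) ^ ((2 : ℝ) / s))) := by
    refine (ContinuousAt.tendsto ?_).mono_left nhdsWithin_le_nhds
    exact continuousAt_const.mul (ContinuousAt.rpow_const (by fun_prop) (Or.inr (by positivity)))
  refine ge_of_tendsto hc ?_
  filter_upwards [self_mem_nhdsWithin] with q hq
  have hq : r < q := hq
  exact IsAdmissible.sum_sq_le hs (hr.trans_lt hq)
    (memP.isAdmissible (hs := hs) ⟨hx.1, hx.2.1, fun z hz => (hx.2.2 z hz).trans hq.le⟩)

/-- Let `s ≥ 2` and `r ≥ 0`.  Define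
`x_k = 2 (r/2)^{1/s} cos (π (2(s−k)+1) / (2s))` for `k = 1, …, s`
(the increasingly ordered zeros of `r T_s(z r^{-1/s} 2^{(1−s)/s})`); here `k = 1, …, s`
is reindexed by `k : Fin s` (so `x` below at `k : Fin s` is `x_{k+1}`).  Then
`x ∈ 𝒫_s(r)` and `∑_{k=1}^s x_k² = 2s (r/2)^{2/s}`; consequently
`sup_{x ∈ 𝒫_s(r)} ∑_{n=1}^s x_n² = 2s (r/2)^{2/s}` (and it is attained, i.e. it is
a greatest value). -/
theorem stmt14 (s : ℕ) (hs : 2 ≤ s) (r : ℝ) (hr : 0 ≤ r)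
    (x : Fin s → ℝ)
    (hxdef : ∀ k : Fin s,
      x k = 2 * (r / 2) ^ ((1 : ℝ) / s) *
        Real.cos (π * (2 * ((s : ℝ) - ((k : ℕ) + 1)) + 1) / (2 * s))) :
    memP s hs r x ∧
    (∑ k, (x k) ^ 2 = 2 * s * (r / 2) ^ ((2 : ℝ) / s)) ∧
    IsGreatest {t : ℝ | ∃ y : Fin s → ℝ, memP s hs r y ∧ t = ∑ n, (y n) ^ 2}
      (2 * s * (r / 2) ^ ((2 : ℝ) / s)) := by
  have hs0 : (0 : ℝ) < s := by positivity
  have hs2 : (2 : ℝ) ≤ s := by exact_mod_cast hs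
  rw [rpow_two_div (by positivity)]
  set κ := (r / 2) ^ ((1 : ℝ) / s) with hκ
  have hκ0 : 0 ≤ κ := by positivity
  have hκs : κ ^ s = r / 2 := by
    rw [hκ, one_div, Real.rpow_inv_natCast_pow (by positivity) (by omega)]
  have hxj : ∀ k : Fin s, x k =
      2 * κ * Real.cos ((2 * ((s - 1 - (k : ℕ) : ℕ) : ℝ) + 1) * π / (2 * s)) := by
    intro k
    rw [hxdef, Nat.cast_sub (by omega), Nat.cast_sub (by omega)]
    congr 2
    push_cast
    ring
  have hsin : ∀ φ : ℝ, 0 < φ → φ < π → Real.sin φ ≠ 0 := fun φ h1 h2 =>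
    (Real.sin_pos_of_pos_of_lt_pi h1 h2).ne'
  have hsum : ∑ k, x k = 0 := by
    simp_rw [hxj]
    rw [Fin.sum_univ_eq_sum_range
        (fun k => 2 * κ * Real.cos ((2 * ((s - 1 - k : ℕ) : ℝ) + 1) * π / (2 * s))) s,
      Finset.sum_range_reflect (fun k => 2 * κ * Real.cos ((2 * (k : ℝ) + 1) * π / (2 * s))) s,
      ← Finset.mul_sum]
    have := sum_range_cos_odd_mul (s := s) (φ := π / (2 * s))
      (hsin _ (by positivity) (div_lt_self Real.pi_pos (by linarith)))
      (by rw [mul_div_cancel₀ _ (by positivity), Real.sin_pi])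
    simp only [mul_div_assoc, this, mul_zero]
  have hsq : ∑ k, x k ^ 2 = 2 * s * κ ^ 2 := by
    have hcos : ∀ k : Fin s, x k ^ 2 = 2 * κ ^ 2 +
        2 * κ ^ 2 * Real.cos ((2 * ((s - 1 - (k : ℕ) : ℕ) : ℝ) + 1) * π / s) := by
      intro k
      have e : (2 * ((s - 1 - (k : ℕ) : ℕ) : ℝ) + 1) * π / s =
        2 * ((2 * ((s - 1 - (k : ℕ) : ℕ) : ℝ) + 1) * π / (2 * s)) := by field_simp
      rw [hxj, e, Real.cos_two_mul]; ring
    simp_rw [hcos]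
    rw [Finset.sum_add_distrib, Finset.sum_const, Fin.sum_univ_eq_sum_range
        (fun k => 2 * κ ^ 2 * Real.cos ((2 * ((s - 1 - k : ℕ) : ℝ) + 1) * π / s)) s,
      Finset.sum_range_reflect (fun k => 2 * κ ^ 2 * Real.cos ((2 * (k : ℝ) + 1) * π / s)) s,
      ← Finset.mul_sum]
    have := sum_range_cos_odd_mul (s := s) (φ := π / s)
      (hsin _ (by positivity) (div_lt_self Real.pi_pos (by linarith)))
      (by rw [mul_assoc, mul_div_cancel₀ _ (by positivity), Real.sin_two_pi])
    simp only [mul_div_assoc, this, mul_zero]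
    simp
    ring
  have hmono : Monotone x := by
    intro a b hab
    rw [hxdef, hxdef]
    have ha : ((a : ℕ) : ℝ) + 1 ≤ s := by exact_mod_cast a.2
    have hb : ((b : ℕ) : ℝ) + 1 ≤ s := by exact_mod_cast b.2
    have hab : ((a : ℕ) : ℝ) ≤ (b : ℕ) := by exact_mod_cast hab
    have ha0 : (0 : ℝ) ≤ (a : ℕ) := Nat.cast_nonneg _
    refine mul_le_mul_of_nonneg_left (Real.cos_le_cos_of_nonneg_of_le_pi ?_ ?_ ?_) (by positivity)
    · exact div_nonneg (mul_nonneg Real.pi_pos.le (by linarith)) (by positivity)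
    · rw [div_le_iff₀ (by positivity)]
      exact mul_le_mul_of_nonneg_left (by linarith) Real.pi_pos.le
    · gcongr
  have hxabs : ∀ k, |x k| ≤ 2 * κ := fun k => by
    rw [hxdef, abs_mul, abs_of_nonneg (by positivity : 0 ≤ 2 * κ)]
    exact mul_le_of_le_one_right (by positivity) (Real.abs_cos_le_one _)
  have hmem : memP s hs r x := by
    refine ⟨hmono, hsum, fun z hz => ?_⟩
    have hzl := (abs_le.1 (hxabs ⟨0, by omega⟩)).1.trans hz.1
    have hzu := hz.2.trans (abs_le.1 (hxabs ⟨s - 1, by omega⟩)).2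
    rcases hκ0.eq_or_lt with h0 | hpos
    · have hx0 : z - x ⟨0, by omega⟩ = 0 := by
        rw [hxdef, ← h0]; rw [← h0] at hzl hzu; linarith
      rw [Finset.prod_eq_zero (Finset.mem_univ (⟨0, by omega⟩ : Fin s)) hx0, abs_zero]; exact hr
    · set y := z / (2 * κ) with hy
      have hzy : z = 2 * κ * y := by rw [hy]; field_simp
      have hy1 : |y| ≤ 1 := by
        rw [hy, abs_div, abs_of_pos (by positivity : 0 < 2 * κ), div_le_one (by positivity)]
        exact abs_le.2 ⟨hzl, hzu⟩
      have hprod : ∏ n, (z - x n) = r * (Polynomial.Chebyshev.T ℝ s).eval y := by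
        simp_rw [hxj, hzy, ← mul_sub]
        rw [Finset.prod_mul_distrib, Fin.prod_univ_eq_prod_range
            (fun k => y - Real.cos ((2 * ((s - 1 - k : ℕ) : ℝ) + 1) * π / (2 * s))) s,
          Finset.prod_range_reflect
            (fun k => y - Real.cos ((2 * (k : ℝ) + 1) * π / (2 * s))) s,
          eval_chebyshev_T_eq_prod, ← mul_assoc]
        congr 1
        obtain ⟨m, rfl⟩ := Nat.exists_eq_add_of_le' hs
        simp only [Finset.prod_const, Finset.card_univ, Fintype.card_fin, mul_pow, hκs]
        rw [show m + 2 - 1 = m + 1 by omega]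
        ring
      rw [hprod, abs_mul, abs_of_nonneg hr]
      exact mul_le_of_le_one_right hr (Polynomial.Chebyshev.abs_eval_T_real_le_one _ hy1)
  refine ⟨hmem, hsq, ⟨x, hmem, hsq.symm⟩, ?_⟩
  rintro t ⟨y, hy, rfl⟩
  have := hy.sum_sq_le hr
  rwa [rpow_two_div (by positivity)] at this
end
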